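/- Let f : ℝ² → ℍ with ∫_{ℝ²} |f(s,t)| ds dt < ∞, and suppose its left-sided quaternion Fourier transform 𝓕_L satisfies ∫_{ℝ²} |𝓕_L(u,v)| du dv < ∞. Then f(s,t) = (1/(4π²)) ∫_{ℝ²} e^{j t v} e^{i s u} 𝓕_L(u,v) du dv for almost every (s,t) ∈ ℝ². -/

import Mathlib

open MeasureTheory Filter Real Set
open scoped Quaternion Topology

noncomputable section

def qi : ℍ[ℝ] := ⟨0,1,0,0⟩
def qj : ℍ[ℝ] := ⟨0,0,1,0⟩

/-- `e^{μθ} = cos θ + μ sin θ` for a (pure unit) quaternion `μ`. -/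
def qexp (μ : ℍ[ℝ]) (θ : ℝ) : ℍ[ℝ] := (Real.cos θ : ℍ[ℝ]) + Real.sin θ • μ

/-- Left-sided quaternion Fourier transform. -/
def QFT_L (f : ℝ × ℝ → ℍ[ℝ]) (u v : ℝ) : ℍ[ℝ] :=
  ∫ p : ℝ × ℝ, qexp qi (-(u * p.1)) * qexp qj (-(v * p.2)) * f p



@[simp] lemma qi_re : qi.re = 0 := rfl
@[simp] lemma qi_imI : qi.imI = 1 := rfl
@[simp] lemma qi_imJ : qi.imJ = 0 := rfl
@[simp] lemma qi_imK : qi.imK = 0 := rfl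
@[simp] lemma qj_re : qj.re = 0 := rfl
@[simp] lemma qj_imI : qj.imI = 0 := rfl
@[simp] lemma qj_imJ : qj.imJ = 1 := rfl
@[simp] lemma qj_imK : qj.imK = 0 := rfl

lemma qexp_continuous (μ : ℍ[ℝ]) : Continuous (qexp μ) := by
  unfold qexp
  have h : Continuous (fun x : ℝ => (x : ℍ[ℝ])) := Quaternion.continuous_coe
  exact (h.comp Real.continuous_cos).add (Real.continuous_sin.smul continuous_const)

lemma norm_qexp_qi (θ : ℝ) : ‖qexp qi θ‖ = 1 := by
  have h : ‖qexp qi θ‖ * ‖qexp qi θ‖ = 1 := by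
    rw [← Quaternion.normSq_eq_norm_mul_self, Quaternion.normSq_def']
    simp [qexp]
  nlinarith [norm_nonneg (qexp qi θ)]

lemma norm_qexp_qj (θ : ℝ) : ‖qexp qj θ‖ = 1 := by
  have h : ‖qexp qj θ‖ * ‖qexp qj θ‖ = 1 := by
    rw [← Quaternion.normSq_eq_norm_mul_self, Quaternion.normSq_def']
    simp [qexp]
  nlinarith [norm_nonneg (qexp qj θ)]

lemma qi_sq : qi * qi = -1 := by
  ext <;> simp

lemma qj_sq : qj * qj = -1 := by
  ext <;> simp

/-- The embedding of the complex plane sending `I` to `μ`. -/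
def embC (μ : ℍ[ℝ]) (h : μ * μ = -1) : ℂ →L[ℝ] ℍ[ℝ] :=
  LinearMap.toContinuousLinearMap (Complex.liftAux μ h).toLinearMap

lemma embC_mul (μ : ℍ[ℝ]) (h : μ * μ = -1) (z w : ℂ) :
    embC μ h (z * w) = embC μ h z * embC μ h w := by
  exact map_mul (Complex.liftAux μ h) z w

lemma embC_ofReal (μ : ℍ[ℝ]) (h : μ * μ = -1) (x : ℝ) :
    embC μ h (x : ℂ) = (x : ℍ[ℝ]) := by
  simp [embC]

lemma embC_exp (μ : ℍ[ℝ]) (h : μ * μ = -1) (θ : ℝ) :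
    embC μ h (Complex.exp (θ * Complex.I)) = qexp μ θ := by
  simp [embC, Complex.liftAux_apply, qexp, Complex.exp_ofReal_mul_I_re, Complex.exp_ofReal_mul_I_im]

/-- One-dimensional transform of a real test function. -/
def tr (μ : ℍ[ℝ]) (a : ℝ → ℝ) (u : ℝ) : ℍ[ℝ] := ∫ s : ℝ, a s • qexp μ (s * u)

open scoped ContDiff FourierTransform SchwartzMap in
lemma tr_spec (μ : ℍ[ℝ]) (h : μ * μ = -1) (a : ℝ → ℝ) (ha : ContDiff ℝ ∞ a)
    (hc : HasCompactSupport a) :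
    Integrable (tr μ a) ∧ ∀ r : ℝ, ∫ u, tr μ a u * qexp μ (-(u * r)) = (2 * π * a r) • (1 : ℍ[ℝ]) := by
  have hc' : HasCompactSupport (fun x => (a x : ℂ)) := hc.comp_left (g := fun x : ℝ => (x : ℂ)) (by simp)
  have ha' : ContDiff ℝ ∞ (fun x => (a x : ℂ)) := Complex.ofRealCLM.contDiff.comp ha
  set φ : 𝓢(ℝ, ℂ) := hc'.toSchwartzMap ha' with hφ
  have hφa : ∀ x, φ x = (a x : ℂ) := fun x => rfl
  set ψ : 𝓢(ℝ, ℂ) := 𝓕 φ with hψ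
  have hpi : (2 * π) ≠ 0 := by positivity
  have key : ∀ u, tr μ a u = embC μ h (ψ (-(2 * π)⁻¹ * u)) := by
    intro u
    have e1 : ψ (-(2 * π)⁻¹ * u) = ∫ s, Complex.exp (((s * u : ℝ) : ℂ) * Complex.I) * (a s : ℂ) := by
      rw [hψ, SchwartzMap.fourier_coe, Real.fourier_real_eq_integral_exp_smul]
      refine integral_congr_ae (.of_forall fun s => ?_)
      simp only [smul_eq_mul, hφa]
      congr 3
      push_cast
      field_simp
    rw [e1, ← ContinuousLinearMap.integral_comp_comm]
    · unfold tr
      refine integral_congr_ae (.of_forall fun s => ?_)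
      simp only [embC_mul, embC_exp, embC_ofReal]
      rw [Quaternion.mul_coe_eq_smul]
    · refine Continuous.integrable_of_hasCompactSupport ?_ ?_
      · have := ha'.continuous
        fun_prop
      · exact hc'.mul_left
  have hpsi_int : Integrable (fun u => ψ (-(2 * π)⁻¹ * u)) :=
    (SchwartzMap.integrable ψ (μ := volume)).comp_mul_left' (by simp [Real.pi_ne_zero])
  refine ⟨?_, fun r => ?_⟩
  · have := (embC μ h).integrable_comp hpsi_int
    exact this.congr (.of_forall fun u => (key u).symm)
  · have hinv : 𝓕⁻ (𝓕 (fun x => φ x)) r = (a r : ℂ) := by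
      rw [Continuous.fourierInv_fourier_eq φ.continuous φ.integrable
        (SchwartzMap.integrable ψ (μ := volume))]
      exact hφa r
    have e2 : ∀ u, tr μ a u * qexp μ (-(u * r)) = embC μ h
        ((fun w : ℝ => Complex.exp (((2 * π * w * r : ℝ) : ℂ) * Complex.I) * ψ w) (-(2 * π)⁻¹ * u)) := by
      intro u
      simp only
      rw [mul_comm (Complex.exp _), embC_mul, key, embC_exp]
      congr 2
      field_simp
    simp_rw [e2]
    rw [ContinuousLinearMap.integral_comp_comm,
      Measure.integral_comp_mul_left (fun w : ℝ => Complex.exp (((2 * π * w * r : ℝ) : ℂ) * Complex.I) * ψ w)]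
    · have e3 : (∫ w : ℝ, Complex.exp (((2 * π * w * r : ℝ) : ℂ) * Complex.I) * ψ w) = (a r : ℂ) := by
        rw [← hinv, Real.fourierInv_eq']
        refine integral_congr_ae (.of_forall fun w => ?_)
        simp only [smul_eq_mul]
        congr 3
        simp
        ring
      rw [e3, map_smul, embC_ofReal]
      have : |(-(2 * π)⁻¹)⁻¹| = 2 * π := by
        rw [inv_neg, inv_inv, abs_neg, abs_of_pos (by positivity)]
      rw [this, mul_smul]
      ext <;> simp [mul_assoc]
    · refine hpsi_int.bdd_mul (c := 1) (Continuous.aestronglyMeasurable (by fun_prop)) (.of_forall fun u => ?_)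
      rw [Complex.norm_exp_ofReal_mul_I]

lemma hcs_prod (a b : ℝ → ℝ) (ha : HasCompactSupport a) (hb : HasCompactSupport b) :
    HasCompactSupport (fun p : ℝ × ℝ => a p.1 * b p.2) := by
  refine HasCompactSupport.of_support_subset_isCompact (K := tsupport a ×ˢ tsupport b)
    (IsCompact.prod ha hb) fun p hp => ?_
  simp only [Function.mem_support, ne_eq, mul_eq_zero, not_or] at hp
  exact ⟨subset_tsupport _ hp.1, subset_tsupport _ hp.2⟩

/-- The candidate inverse. -/
def invG (f : ℝ × ℝ → ℍ[ℝ]) (p : ℝ × ℝ) : ℍ[ℝ] :=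
  (1 / (4 * π ^ 2)) • ∫ q : ℝ × ℝ, qexp qj (p.2 * q.2) * qexp qi (p.1 * q.1) * QFT_L f q.1 q.2

lemma invG_continuous (f : ℝ × ℝ → ℍ[ℝ])
    (hF : Integrable (fun p : ℝ × ℝ => QFT_L f p.1 p.2)) : Continuous (invG f) := by
  have hi := qexp_continuous qi
  have hj := qexp_continuous qj
  unfold invG
  suffices hh : Continuous (fun p : ℝ × ℝ => ∫ q : ℝ × ℝ,
      qexp qj (p.2 * q.2) * qexp qi (p.1 * q.1) * QFT_L f q.1 q.2) from
      hh.const_smul (1 / (4 * π ^ 2) : ℝ)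
  refine continuous_of_dominated (bound := fun q => ‖QFT_L f q.1 q.2‖) (fun p => ?_) (fun p => ?_)
    hF.norm ?_
  · refine AEStronglyMeasurable.mul (Continuous.aestronglyMeasurable ?_) hF.aestronglyMeasurable
    fun_prop
  · refine .of_forall fun q => ?_
    simp [norm_qexp_qi, norm_qexp_qj]
  · refine .of_forall fun q => ?_
    fun_prop

open scoped ContDiff in
lemma kernel_inv (a b : ℝ → ℝ) (ha : ContDiff ℝ ∞ a) (hb : ContDiff ℝ ∞ b)
    (hac : HasCompactSupport a) (hbc : HasCompactSupport b) (r : ℝ × ℝ) :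
    ∫ q : ℝ × ℝ, tr qj b q.2 * tr qi a q.1 * (qexp qi (-(q.1 * r.1)) * qexp qj (-(q.2 * r.2)))
      = (4 * π ^ 2 * (a r.1 * b r.2)) • (1 : ℍ[ℝ]) := by
  have hi := qexp_continuous qi
  have hj := qexp_continuous qj
  obtain ⟨iA, eA⟩ := tr_spec qi qi_sq a ha hac
  obtain ⟨iB, eB⟩ := tr_spec qj qj_sq b hb hbc
  have iAe : ∀ x, Integrable (fun u => tr qi a u * qexp qi (-(u * x))) := fun x =>
    iA.mul_bdd (c := 1) (Continuous.aestronglyMeasurable (by fun_prop))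
      (.of_forall fun u => (norm_qexp_qi _).le)
  have iBe : ∀ x, Integrable (fun u => tr qj b u * qexp qj (-(u * x))) := fun x =>
    iB.mul_bdd (c := 1) (Continuous.aestronglyMeasurable (by fun_prop))
      (.of_forall fun u => (norm_qexp_qj _).le)
  rw [Measure.volume_eq_prod, integral_prod_symm]
  · have e1 : ∀ y, ∫ x, tr qj b y * tr qi a x * (qexp qi (-(x * r.1)) * qexp qj (-(y * r.2)))
        = (2 * π * a r.1) • (tr qj b y * qexp qj (-(y * r.2))) := by
      intro y
      have : ∀ x, tr qj b y * tr qi a x * (qexp qi (-(x * r.1)) * qexp qj (-(y * r.2)))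
        = tr qj b y * ((tr qi a x * qexp qi (-(x * r.1))) * qexp qj (-(y * r.2))) := by
        intro x; simp only [mul_assoc]
      simp_rw [this]
      rw [integral_const_mul_of_integrable ((iAe _).mul_const _),
        integral_mul_const_of_integrable (iAe _), eA]
      simp
    simp only [e1]
    rw [integral_smul, eB, smul_smul]
    congr 1
    ring
  · have h0 : Integrable (fun q : ℝ × ℝ => tr qj b q.2 * tr qi a q.1) (volume.prod volume) :=
      (iB.mul_prod iA).swap
    exact h0.mul_bdd (c := 1) (Continuous.aestronglyMeasurable (by fun_prop))
      (.of_forall fun u => by simp [norm_qexp_qi, norm_qexp_qj])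

open scoped ContDiff in
lemma test_eq (f : ℝ × ℝ → ℍ[ℝ]) (hf : Integrable f)
    (hF : Integrable (fun p : ℝ × ℝ => QFT_L f p.1 p.2))
    (a b : ℝ → ℝ) (ha : ContDiff ℝ ∞ a) (hb : ContDiff ℝ ∞ b)
    (hac : HasCompactSupport a) (hbc : HasCompactSupport b) :
    ∫ p : ℝ × ℝ, (a p.1 * b p.2) • invG f p = ∫ p : ℝ × ℝ, (a p.1 * b p.2) • f p := by
  have hi := qexp_continuous qi
  have hj := qexp_continuous qj
  have ca := ha.continuous
  have cb := hb.continuous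
  obtain ⟨iA, -⟩ := tr_spec qi qi_sq a ha hac
  obtain ⟨iB, -⟩ := tr_spec qj qj_sq b hb hbc
  have ia : Integrable a := ca.integrable_of_hasCompactSupport hac
  have ib : Integrable b := cb.integrable_of_hasCompactSupport hbc
  have iab : Integrable (fun p : ℝ × ℝ => a p.1 * b p.2) := ia.mul_prod ib
  have iae : ∀ x, Integrable (fun s => a s • qexp qi (s * x)) := fun x =>
    Continuous.integrable_of_hasCompactSupport (by fun_prop) hac.smul_right
  have ibe : ∀ x, Integrable (fun s => b s • qexp qj (s * x)) := fun x =>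
    Continuous.integrable_of_hasCompactSupport (by fun_prop) hbc.smul_right
  -- first Fubini
  have s1 : ∫ p : ℝ × ℝ, (a p.1 * b p.2) • ∫ q : ℝ × ℝ,
        qexp qj (p.2 * q.2) * qexp qi (p.1 * q.1) * QFT_L f q.1 q.2
      = ∫ q : ℝ × ℝ, tr qj b q.2 * tr qi a q.1 * QFT_L f q.1 q.2 := by
    simp_rw [← integral_smul]
    rw [integral_integral_swap]
    · refine integral_congr_ae (.of_forall fun q => ?_)
      simp only
      have e : ∀ p : ℝ × ℝ, (a p.1 * b p.2) • (qexp qj (p.2 * q.2) * qexp qi (p.1 * q.1) * QFT_L f q.1 q.2)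
          = ((b p.2 • qexp qj (p.2 * q.2)) * (a p.1 • qexp qi (p.1 * q.1))) * QFT_L f q.1 q.2 := by
        intro p
        simp only [smul_mul_assoc, mul_smul_comm, smul_smul]
      simp_rw [e]
      have i2 : Integrable (fun p : ℝ × ℝ => (b p.2 • qexp qj (p.2 * q.2)) * (a p.1 • qexp qi (p.1 * q.1)))
          (volume.prod volume) := ((ibe q.2).mul_prod (iae q.1)).swap
      rw [Measure.volume_eq_prod, integral_mul_const_of_integrable i2]
      congr 1
      rw [integral_prod_symm _ i2]
      simp only
      have : ∀ y, ∫ x, (b y • qexp qj (y * q.2)) * (a x • qexp qi (x * q.1))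
          = (b y • qexp qj (y * q.2)) * tr qi a q.1 := fun y =>
        integral_const_mul_of_integrable (iae q.1)
      simp_rw [this]
      exact integral_mul_const_of_integrable (ibe q.2)
    · have h0 : Integrable (fun z : (ℝ × ℝ) × (ℝ × ℝ) => (a z.1.1 * b z.1.2) • QFT_L f z.2.1 z.2.2)
          (volume.prod volume) := iab.smul_prod hF
      have h1 := h0.bdd_mul (c := 1)
        (f := fun z : (ℝ × ℝ) × (ℝ × ℝ) => qexp qj (z.1.2 * z.2.2) * qexp qi (z.1.1 * z.2.1))
        (Continuous.aestronglyMeasurable (by fun_prop))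
        (.of_forall fun u => by simp [norm_qexp_qi, norm_qexp_qj])
      refine h1.congr (.of_forall fun z => ?_)
      simp [Function.uncurry]
  -- second Fubini
  have s2 : ∫ q : ℝ × ℝ, tr qj b q.2 * tr qi a q.1 * QFT_L f q.1 q.2
      = ∫ r : ℝ × ℝ, (4 * π ^ 2 * (a r.1 * b r.2)) • f r := by
    have iBA : Integrable (fun q : ℝ × ℝ => tr qj b q.2 * tr qi a q.1) := (iB.mul_prod iA).swap
    have e : ∀ q : ℝ × ℝ, tr qj b q.2 * tr qi a q.1 * QFT_L f q.1 q.2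
        = ∫ r : ℝ × ℝ, tr qj b q.2 * tr qi a q.1 *
            (qexp qi (-(q.1 * r.1)) * qexp qj (-(q.2 * r.2))) * f r := by
      intro q
      unfold QFT_L
      rw [← integral_const_mul_of_integrable]
      · simp only [mul_assoc]
      · exact hf.bdd_mul (c := 1) (Continuous.aestronglyMeasurable (by fun_prop))
          (.of_forall fun u => by simp [norm_qexp_qi, norm_qexp_qj])
    simp_rw [e]
    rw [integral_integral_swap]
    · refine integral_congr_ae (.of_forall fun r => ?_)
      simp only
      rw [integral_mul_const_of_integrable, kernel_inv a b ha hb hac hbc]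
      · simp
      · exact iBA.mul_bdd (c := 1) (Continuous.aestronglyMeasurable (by fun_prop))
          (.of_forall fun u => by simp [norm_qexp_qi, norm_qexp_qj])
    · have m1 : AEStronglyMeasurable (fun z : (ℝ × ℝ) × (ℝ × ℝ) => tr qj b z.1.2 * tr qi a z.1.1)
          (volume.prod volume) := iBA.aestronglyMeasurable.comp_fst
      have m2 : AEStronglyMeasurable (fun z : (ℝ × ℝ) × (ℝ × ℝ) => f z.2)
          (volume.prod volume) := hf.aestronglyMeasurable.comp_snd
      have m3 : AEStronglyMeasurable (fun z : (ℝ × ℝ) × (ℝ × ℝ) =>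
          qexp qi (-(z.1.1 * z.2.1)) * qexp qj (-(z.1.2 * z.2.2)))
          (volume.prod volume) := Continuous.aestronglyMeasurable (by fun_prop)
      refine (iBA.mul_prod hf).mono ((m1.mul m3).mul m2) (.of_forall fun z => ?_)
      simp [Function.uncurry, norm_qexp_qi, norm_qexp_qj]
  have hpi : (4 * π ^ 2) ≠ 0 := by positivity
  have s3 : ∫ p : ℝ × ℝ, (a p.1 * b p.2) • invG f p = (1 / (4 * π ^ 2)) •
      ∫ p : ℝ × ℝ, (a p.1 * b p.2) • ∫ q : ℝ × ℝ,
        qexp qj (p.2 * q.2) * qexp qi (p.1 * q.1) * QFT_L f q.1 q.2 := by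
    rw [← integral_smul]
    refine integral_congr_ae (.of_forall fun p => ?_)
    simp only [invG]
    rw [smul_comm]
  rw [s3, s1, s2, ← integral_smul]
  refine integral_congr_ae (.of_forall fun p => ?_)
  simp only [smul_smul]
  congr 1
  field_simp

/-- Smooth approximations of the indicator of `[x - r, x + r]`. -/
def bumpA (x r : ℝ) (n : ℕ) (s : ℝ) : ℝ :=
  smoothTransition (1 + (n + 1) * (s - (x - r))) * smoothTransition (1 + (n + 1) * (x + r - s))

open scoped ContDiff in
lemma bumpA_contDiff (x r : ℝ) (n : ℕ) : ContDiff ℝ ∞ (bumpA x r n) := by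
  unfold bumpA
  have h : ContDiff ℝ ∞ smoothTransition := smoothTransition.contDiff
  exact (h.comp (by fun_prop)).mul (h.comp (by fun_prop))

lemma bumpA_zero (x r : ℝ) (n : ℕ) (s : ℝ) (hs : s ∉ Metric.closedBall x (r + 1)) :
    bumpA x r n s = 0 := by
  rw [Real.closedBall_eq_Icc, mem_Icc, not_and_or, not_le, not_le] at hs
  have hn : (0 : ℝ) ≤ n := n.cast_nonneg
  unfold bumpA
  rcases hs with hs | hs
  · rw [smoothTransition.zero_of_nonpos, zero_mul]
    nlinarith
  · rw [mul_comm, smoothTransition.zero_of_nonpos, zero_mul]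
    nlinarith

lemma bumpA_compact (x r : ℝ) (n : ℕ) : HasCompactSupport (bumpA x r n) :=
  HasCompactSupport.intro (isCompact_closedBall x (r + 1)) fun s hs => bumpA_zero x r n s hs

lemma bumpA_abs_le (x r : ℝ) (n : ℕ) (s : ℝ) : |bumpA x r n s| ≤ 1 := by
  unfold bumpA
  rw [abs_of_nonneg (mul_nonneg (smoothTransition.nonneg _) (smoothTransition.nonneg _))]
  exact mul_le_one₀ (smoothTransition.le_one _) (smoothTransition.nonneg _) (smoothTransition.le_one _)

lemma bumpA_in (x r : ℝ) (n : ℕ) (s : ℝ) (hs : s ∈ Metric.closedBall x r) :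
    bumpA x r n s = 1 := by
  rw [Real.closedBall_eq_Icc, mem_Icc] at hs
  have hn : (0 : ℝ) ≤ n := n.cast_nonneg
  unfold bumpA
  rw [smoothTransition.one_of_one_le, smoothTransition.one_of_one_le, one_mul]
  · nlinarith
  · nlinarith

lemma bumpA_out (x r : ℝ) (s : ℝ) (hs : s ∉ Metric.closedBall x r) :
    ∀ᶠ n : ℕ in atTop, bumpA x r n s = 0 := by
  rw [Real.closedBall_eq_Icc, mem_Icc, not_and_or, not_le, not_le] at hs
  rcases hs with hs | hs
  · obtain ⟨N, hN⟩ := exists_nat_gt (1 / ((x - r) - s))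
    filter_upwards [eventually_ge_atTop N] with n hn
    have hn' : (N : ℝ) ≤ n := by exact_mod_cast hn
    have hd : 0 < (x - r) - s := by linarith
    rw [div_lt_iff₀ hd] at hN
    unfold bumpA
    rw [smoothTransition.zero_of_nonpos, zero_mul]
    nlinarith
  · obtain ⟨N, hN⟩ := exists_nat_gt (1 / (s - (x + r)))
    filter_upwards [eventually_ge_atTop N] with n hn
    have hn' : (N : ℝ) ≤ n := by exact_mod_cast hn
    have hd : 0 < s - (x + r) := by linarith
    rw [div_lt_iff₀ hd] at hN
    unfold bumpA
    rw [mul_comm, smoothTransition.zero_of_nonpos, zero_mul]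
    nlinarith

open scoped ContDiff in
lemma box_zero (h : ℝ × ℝ → ℍ[ℝ]) (hl : LocallyIntegrable h)
    (H : ∀ a b : ℝ → ℝ, ContDiff ℝ ∞ a → ContDiff ℝ ∞ b → HasCompactSupport a →
      HasCompactSupport b → ∫ p : ℝ × ℝ, (a p.1 * b p.2) • h p = 0) (x : ℝ × ℝ) (r : ℝ) :
    ∫ p in Metric.closedBall x r, h p = 0 := by
  have hball : ∀ (r : ℝ) (p : ℝ × ℝ), p ∈ Metric.closedBall x r ↔
      p.1 ∈ Metric.closedBall x.1 r ∧ p.2 ∈ Metric.closedBall x.2 r := by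
    intro r p
    rw [← mem_prod, closedBall_prod_same]
  rw [← integral_indicator Metric.isClosed_closedBall.measurableSet]
  have hlim : Tendsto (fun n : ℕ => ∫ p : ℝ × ℝ, (bumpA x.1 r n p.1 * bumpA x.2 r n p.2) • h p) atTop
      (𝓝 (∫ p, (Metric.closedBall x r).indicator h p)) := by
    refine tendsto_integral_of_dominated_convergence
      ((Metric.closedBall x (r + 1)).indicator (fun p => ‖h p‖)) (fun n => ?_) ?_ (fun n => ?_) ?_
    · have h1 := (bumpA_contDiff x.1 r n).continuous
      have h2 := (bumpA_contDiff x.2 r n).continuous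
      have h3 : Continuous (fun p : ℝ × ℝ => bumpA x.1 r n p.1 * bumpA x.2 r n p.2) := by fun_prop
      exact h3.aestronglyMeasurable.smul hl.aestronglyMeasurable
    · rw [integrable_indicator_iff Metric.isClosed_closedBall.measurableSet]
      exact (hl.integrableOn_isCompact (isCompact_closedBall _ _)).norm
    · refine .of_forall fun p => ?_
      by_cases hp : p ∈ Metric.closedBall x (r + 1)
      · rw [indicator_of_mem hp, norm_smul, norm_mul, Real.norm_eq_abs, Real.norm_eq_abs]
        exact mul_le_of_le_one_left (norm_nonneg _)
          (mul_le_one₀ (bumpA_abs_le _ _ _ _) (abs_nonneg _) (bumpA_abs_le _ _ _ _))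
      · rw [indicator_of_notMem hp]
        rw [hball, not_and_or] at hp
        rcases hp with hp | hp
        · simp [bumpA_zero _ _ _ _ hp]
        · simp [bumpA_zero _ _ _ _ hp]
    · refine .of_forall fun p => ?_
      by_cases hp : p ∈ Metric.closedBall x r
      · rw [indicator_of_mem hp]
        rw [hball] at hp
        simp [bumpA_in _ _ _ _ hp.1, bumpA_in _ _ _ _ hp.2]
      · rw [indicator_of_notMem hp]
        rw [hball, not_and_or] at hp
        refine tendsto_const_nhds.congr' ?_
        rcases hp with hp | hp
        · filter_upwards [bumpA_out _ _ _ hp] with n hn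
          simp [hn]
        · filter_upwards [bumpA_out _ _ _ hp] with n hn
          simp [hn]
  refine tendsto_nhds_unique hlim (tendsto_const_nhds.congr fun n => ?_)
  exact (H _ _ (bumpA_contDiff _ _ _) (bumpA_contDiff _ _ _) (bumpA_compact _ _ _)
    (bumpA_compact _ _ _)).symm

/-- Inversion theorem for the left-sided QFT of an integrable function with integrable QFT. -/
theorem qft_left_sided_inversion_L1
    (f : ℝ × ℝ → ℍ[ℝ]) (hf : Integrable f)
    (hF : Integrable (fun p : ℝ × ℝ => QFT_L f p.1 p.2)) :
    ∀ᵐ p : ℝ × ℝ, f p =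
      (1 / (4 * π ^ 2)) • ∫ q : ℝ × ℝ, qexp qj (p.2 * q.2) * qexp qi (p.1 * q.1) * QFT_L f q.1 q.2 := by
  have hg := (invG_continuous f hF).locallyIntegrable (μ := (volume : Measure (ℝ × ℝ)))
  have hfl := hf.locallyIntegrable
  have hl : LocallyIntegrable (fun p => f p - invG f p) := hfl.sub hg
  have hz := box_zero _ hl (fun a b ha hb hac hbc => by
    have hc : Continuous (fun p : ℝ × ℝ => a p.1 * b p.2) := by
      have := ha.continuous
      have := hb.continuous
      fun_prop
    have hs := hcs_prod a b hac hbc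
    simp_rw [smul_sub]
    rw [integral_sub (hfl.integrable_smul_left_of_hasCompactSupport hc hs)
      (hg.integrable_smul_left_of_hasCompactSupport hc hs),
      test_eq f hf hF a b ha hb hac hbc, sub_self])
  filter_upwards [IsUnifLocDoublingMeasure.ae_tendsto_average (μ := (volume : Measure (ℝ × ℝ))) hl 1]
    with p hp
  have h1 := hp (l := 𝓝[>] (0 : ℝ)) (fun _ => p) id tendsto_id (by
    filter_upwards [self_mem_nhdsWithin] with d hd
    have hd' : (0 : ℝ) < d := hd
    simp [hd'.le])
  have h2 : f p - invG f p = 0 := by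
    refine tendsto_nhds_unique h1 ?_
    simp [setAverage_eq, hz]
  exact sub_eq_zero.1 h2
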